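/- arXiv:1208.6501 — 11 statements merged into one kernel-verified Lean document; each statement's English description precedes it below -/
import Mathlib

section
/- A PORF mechanism with price function χ is false-name-proof with withdrawal (FNPW) if and only if χ satisfies the NSAW condition: for every finite multiset O of valuations, running the mechanism on O, and for every pair of disjoint subsets Y, Z of O, if B_i denotes the bundle allocated to agent i ∈ Y, then Σ_{i∈Y} χ(B_i, O − {i}) ≥ χ(⋃_{i∈Y} B_i, O − Y − Z). -/
attribute [local instance] Classical.propDecidable

/-- A valuation over the item set `G`: normalized at `∅`, nonnegative,
and monotone under inclusion (free disposal). -/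
structure Valn (G : Type*) where
  v : Finset G → ℝ
  v_empty : v ∅ = 0
  v_nonneg : ∀ S, 0 ≤ v S
  v_mono : ∀ ⦃S T : Finset G⦄, S ⊆ T → v S ≤ v T

variable {G : Type*} [Fintype G] [DecidableEq G]

/-- A price function: nonnegative, zero on the empty bundle, monotone in the bundle. -/
def IsPrice (χ : Finset G → Multiset (Valn G) → ℝ) : Prop :=
  (∀ S O, 0 ≤ χ S O) ∧ (∀ O, χ (∅ : Finset G) O = 0) ∧
    (∀ ⦃S T : Finset G⦄, S ⊆ T → ∀ O, χ S O ≤ χ T O)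

/-- `X` is the allocation rule of the PORF mechanism with price function `χ`:
each agent receives a bundle maximizing her value minus price, given the
multiset of the other agents' reported valuations. -/
def IsPORF (χ : Finset G → Multiset (Valn G) → ℝ)
    (X : Valn G → Multiset (Valn G) → Finset G) : Prop :=
  ∀ (θ : Valn G) (O : Multiset (Valn G)) (S : Finset G),
    θ.v S - χ S O ≤ θ.v (X θ O) - χ (X θ O) O

/-- The multiset of reports faced by the `j`-th kept false-name identity:
the true other agents `θmi`, the remaining kept identities, and the
withdrawn identities `W`. -/
def othersOf {k : ℕ} (kept : Fin k → Valn G) (j : Fin k)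
    (θmi W : Multiset (Valn G)) : Multiset (Valn G) :=
  θmi + (Finset.univ.erase j).val.map kept + W

/-- False-name-proofness with withdrawal: reporting truthfully with a single
identity is always at least as good as submitting kept false-name reports
`kept 0, …, kept (k-1)` together with withdrawn false-name reports `W`. -/
def FNPW (χ : Finset G → Multiset (Valn G) → ℝ)
    (X : Valn G → Multiset (Valn G) → Finset G) : Prop :=
  ∀ (θi : Valn G) (θmi : Multiset (Valn G)) (k : ℕ)
    (kept : Fin k → Valn G) (W : Multiset (Valn G)),
    θi.v (Finset.univ.sup fun j : Fin k => X (kept j) (othersOf kept j θmi W))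
        - ∑ j : Fin k, χ (X (kept j) (othersOf kept j θmi W)) (othersOf kept j θmi W)
      ≤ θi.v (X θi θmi) - χ (X θi θmi) θmi

/-- No superadditive price increase with withdrawal: running the mechanism on a
multiset `O` of agents, for disjoint sub-multisets `Y`, `Z` of `O`, the total
price paid by the agents in `Y` is at least the price of the union of their
bundles when facing `O - Y - Z`. -/
def NSAW (χ : Finset G → Multiset (Valn G) → ℝ)
    (X : Valn G → Multiset (Valn G) → Finset G) : Prop :=
  ∀ (O Y Z : Multiset (Valn G)), Y + Z ≤ O →
    χ ((Y.map fun i => X i (O.erase i)).sup) (O - Y - Z)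
      ≤ (Y.map fun i => χ (X i (O.erase i)) (O.erase i)).sum

/-- Each kept identity faces all the reports except its own. -/
theorem othersOf_eq_erase {G : Type*} {k : ℕ} (kept : Fin k → Valn G) (j : Fin k)
    (θmi W : Multiset (Valn G)) :
    othersOf kept j θmi W
      = (θmi + Finset.univ.val.map kept + W).erase (kept j) := by
  have h : Finset.univ.val.map kept
      = kept j ::ₘ (Finset.univ.erase j).val.map kept := by
    rw [← Multiset.map_cons, Finset.erase_val,
      Multiset.cons_erase (Finset.mem_univ_val j)]
  rw [h, Multiset.add_cons, Multiset.cons_add, Multiset.erase_cons_head, othersOf]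

/-- The single-minded valuation: worth `c` on every bundle containing `U`, else `0`. -/
noncomputable def Valn.singleMinded (U : Finset G) (hU : U.Nonempty)
    (c : ℝ) (hc : 0 ≤ c) : Valn G where
  v S := if U ⊆ S then c else 0
  v_empty := if_neg fun h => hU.ne_empty (Finset.subset_empty.mp h)
  v_nonneg S := by split_ifs <;> simp [hc]
  v_mono S T hST := by
    by_cases hS : U ⊆ S
    · simp [hS, hS.trans hST]
    · simp only [hS, if_false]
      split_ifs <;> simp [hc]

/-- If every valuation's optimal utility is at least its value for `U` minus `p`,
then the price of `U` is at most `p`. -/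
theorem IsPrice.le_of_forall_utility_le {G : Type*} [DecidableEq G]
    {χ : Finset G → Multiset (Valn G) → ℝ} {X : Valn G → Multiset (Valn G) → Finset G}
    (hχ : IsPrice χ) {U : Finset G} {O : Multiset (Valn G)} {p : ℝ} (hp : 0 ≤ p)
    (h : ∀ θ : Valn G, θ.v U - p ≤ θ.v (X θ O) - χ (X θ O) O) :
    χ U O ≤ p := by
  obtain ⟨hnonneg, hempty, hmono⟩ := hχ
  rcases U.eq_empty_or_nonempty with rfl | hU
  · rwa [hempty]
  · let θ := Valn.singleMinded U hU (p + 1) (by linarith)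
    have hθ := h θ
    have hθU : θ.v U = p + 1 := if_pos subset_rfl
    by_cases hsub : U ⊆ X θ O
    · have hθX : θ.v (X θ O) = p + 1 := if_pos hsub
      linarith [hmono hsub O]
    · have hθX : θ.v (X θ O) = 0 := if_neg hsub
      linarith [hnonneg (X θ O) O]

/-- Any multiset is the image of an indexing by `Fin`. -/
theorem Multiset.exists_map_univ_fin_eq {α : Type*} (Y : Multiset α) :
    ∃ (k : ℕ) (f : Fin k → α), Finset.univ.val.map f = Y :=
  ⟨Y.toList.length, Y.toList.get, by rw [Fin.univ_val_map, List.ofFn_get, Multiset.coe_toList]⟩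

/-- **Theorem 1.** A PORF mechanism with price function `χ` is FNPW if and only
if `χ` satisfies the NSAW condition. -/
theorem fnpw_iff_nsaw (χ : Finset G → Multiset (Valn G) → ℝ)
    (X : Valn G → Multiset (Valn G) → Finset G)
    (hχ : IsPrice χ) (hX : IsPORF χ X) :
    FNPW χ X ↔ NSAW χ X := by
  constructor
  · intro hF O Y Z hYZ
    obtain ⟨k, kept, rfl⟩ := Y.exists_map_univ_fin_eq
    have hO : O - Finset.univ.val.map kept - Z + Finset.univ.val.map kept + Z = O := by
      rw [← Multiset.sub_add_eq_sub_sub, add_assoc, Multiset.sub_add_cancel hYZ]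
    refine hχ.le_of_forall_utility_le (X := X)
      (Multiset.sum_nonneg fun x hx => ?_) fun θ => ?_
    · obtain ⟨i, -, rfl⟩ := Multiset.mem_map.mp hx
      exact hχ.1 _ _
    · have := hF θ (O - Finset.univ.val.map kept - Z) k kept Z
      simp only [othersOf_eq_erase, hO] at this
      simpa only [Multiset.map_map, Function.comp_def, Finset.sup_def, Finset.sum] using this
  · intro hN θ θmi k kept W
    have := hN (θmi + Finset.univ.val.map kept + W) (Finset.univ.val.map kept) W
      (by rw [add_assoc]; exact Multiset.le_add_left _ _)
    have hsub : θmi + Finset.univ.val.map kept + W - Finset.univ.val.map kept - W = θmi := by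
      rw [← Multiset.sub_add_eq_sub_sub, add_assoc, Multiset.add_sub_cancel_right]
    rw [hsub] at this
    simp only [Multiset.map_map, Function.comp_def] at this
    simp only [othersOf_eq_erase, Finset.sup_def, Finset.sum]
    exact (sub_le_sub_left this _).trans (hX θ θmi _)
end

section
/- The price function of the Set mechanism satisfies S-NSAW, i.e., it satisfies both DLB (for every multiset O of valuations and all disjoint S₁, S₂ ⊆ G, χ(S₁,O) + χ(S₂,O) ≥ χ(S₁ ∪ S₂,O)) and PIA (for every multiset O, every valuation a ∉ O, and every S ⊆ G, χ(S, O ∪ {a}) ≥ χ(S,O)). -/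
attribute [local instance] Classical.propDecidable

variable {G : Type*} [Fintype G] [DecidableEq G]

/-- The price function of the Set mechanism: every nonempty bundle is priced at
the highest valuation for the grand bundle among the other agents (`0` if there
are no other agents), and the empty bundle is free. -/
noncomputable def setPrice (S : Finset G) (O : Multiset (Valn G)) : ℝ :=
  if S = ∅ then 0 else (O.map fun j => j.v Finset.univ).fold max 0

theorem setPrice_of_ne_empty {S : Finset G} (hS : S ≠ ∅) (O : Multiset (Valn G)) :
    setPrice S O = (O.map fun j => j.v Finset.univ).fold max 0 :=
  if_neg hS

theorem Multiset.le_fold_max {α : Type*} [LinearOrder α] (b : α) (s : Multiset α) :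
    b ≤ s.fold max b := by
  induction s using Multiset.induction_on with
  | empty => simp
  | cons a s ih => rw [Multiset.fold_cons_left]; exact le_max_of_le_right ih

theorem setPrice_nonneg (S : Finset G) (O : Multiset (Valn G)) : 0 ≤ setPrice S O := by
  by_cases hS : S = ∅
  · simp [setPrice, hS]
  · rw [setPrice_of_ne_empty hS]
    exact Multiset.le_fold_max 0 _

/-- The price function of the Set mechanism satisfies S-NSAW, i.e. both
DLB (discounts for larger bundles) and PIA (prices increase with agents). -/
theorem setPrice_snsaw :
    (∀ (O : Multiset (Valn G)) (S₁ S₂ : Finset G), Disjoint S₁ S₂ →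
      setPrice (S₁ ∪ S₂) O ≤ setPrice S₁ O + setPrice S₂ O) ∧
    (∀ (O : Multiset (Valn G)) (a : Valn G), a ∉ O →
      ∀ S : Finset G, setPrice S O ≤ setPrice S (a ::ₘ O)) := by
  refine ⟨fun O S₁ S₂ _ => ?_, fun O a _ S => ?_⟩
  · by_cases h₁ : S₁ = ∅
    · rw [h₁, Finset.empty_union]
      exact le_add_of_nonneg_left (setPrice_nonneg ∅ O)
    · have h : S₁ ∪ S₂ ≠ ∅ := fun h => h₁ (Finset.union_eq_empty.mp h).1
      rw [setPrice_of_ne_empty h, ← setPrice_of_ne_empty h₁]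
      exact le_add_of_nonneg_right (setPrice_nonneg S₂ O)
  · by_cases hS : S = ∅
    · simp [setPrice, hS]
    · rw [setPrice_of_ne_empty hS, setPrice_of_ne_empty hS, Multiset.map_cons,
        Multiset.fold_cons_left]
      exact le_max_right _ _
end

section
/- The price function of the Minimal Bundle (MB) mechanism satisfies S-NSAW, i.e., it satisfies both DLB (for every multiset O of valuations and all disjoint S₁, S₂ ⊆ G, χ(S₁,O) + χ(S₂,O) ≥ χ(S₁ ∪ S₂,O)) and PIA (for every multiset O, every valuation a ∉ O, and every S ⊆ G, χ(S, O ∪ {a}) ≥ χ(S,O)). -/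
attribute [local instance] Classical.propDecidable

variable {G : Type*} [Fintype G] [DecidableEq G]

/-- A nonempty bundle `T` is minimal for the valuation `w` if every proper
subset of `T` has strictly smaller value. -/
def IsMinimalBundle (w : Valn G) (T : Finset G) : Prop :=
  T ≠ ∅ ∧ ∀ T' ⊂ T, w.v T' < w.v T

/-- The price function of the Minimal Bundle (MB) mechanism: the price of a
bundle `S` is the largest value `v_j(T)` over agents `j` in `O` and bundles `T`
that are minimal for `v_j` and intersect `S` (`0` if no such `j`, `T` exist). -/
noncomputable def mbPrice (S : Finset G) (O : Multiset (Valn G)) : ℝ :=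
  (O.map fun j =>
    (((Finset.univ : Finset (Finset G)).filter
        (fun T => IsMinimalBundle j T ∧ (T ∩ S).Nonempty)).val.map j.v).fold max 0).fold max 0

/-- Universal property of the maximum of a multiset folded from a base value. -/
lemma Multiset.fold_max_le_iff {α : Type*} [LinearOrder α] (s : Multiset α) (b c : α) :
    s.fold max b ≤ c ↔ b ≤ c ∧ ∀ x ∈ s, x ≤ c := by
  induction s using Multiset.induction_on with
  | empty => simp
  | cons a s ih =>
    simp only [Multiset.fold_cons_left, max_le_iff, ih, Multiset.forall_mem_cons]
    tauto

/-- Universal property of the MB price as a maximum. -/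
lemma mbPrice_le_iff (S : Finset G) (O : Multiset (Valn G)) (c : ℝ) :
    mbPrice S O ≤ c ↔ 0 ≤ c ∧ ∀ j ∈ O, ∀ T, IsMinimalBundle j T → (T ∩ S).Nonempty →
      j.v T ≤ c := by
  simp only [mbPrice, Multiset.fold_max_le_iff, Multiset.forall_mem_map_iff, Finset.mem_val,
    Finset.mem_filter, Finset.mem_univ, true_and, and_imp]
  exact and_congr_right fun hc => forall₂_congr fun _ _ => and_iff_right hc

lemma mbPrice_nonneg (S : Finset G) (O : Multiset (Valn G)) : 0 ≤ mbPrice S O :=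
  ((mbPrice_le_iff S O _).1 le_rfl).1

lemma le_mbPrice {S T : Finset G} {O : Multiset (Valn G)} {j : Valn G} (hj : j ∈ O)
    (hT : IsMinimalBundle j T) (hS : (T ∩ S).Nonempty) : j.v T ≤ mbPrice S O :=
  ((mbPrice_le_iff S O _).1 le_rfl).2 j hj T hT hS

/-- The price function of the MB mechanism satisfies S-NSAW, i.e. both
DLB (discounts for larger bundles) and PIA (prices increase with agents). -/
theorem mbPrice_snsaw :
    (∀ (O : Multiset (Valn G)) (S₁ S₂ : Finset G), Disjoint S₁ S₂ →
      mbPrice (S₁ ∪ S₂) O ≤ mbPrice S₁ O + mbPrice S₂ O) ∧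
    (∀ (O : Multiset (Valn G)) (a : Valn G), a ∉ O →
      ∀ S : Finset G, mbPrice S O ≤ mbPrice S (a ::ₘ O)) := by
  refine ⟨fun O S₁ S₂ _ => ?_, fun O a _ S => ?_⟩
  · have h₁ := mbPrice_nonneg S₁ O
    have h₂ := mbPrice_nonneg S₂ O
    refine (mbPrice_le_iff _ _ _).2 ⟨add_nonneg h₁ h₂, fun j hj T hT hS => ?_⟩
    rw [Finset.inter_union_distrib_left, Finset.union_nonempty] at hS
    rcases hS with hS | hS
    · exact (le_mbPrice hj hT hS).trans (le_add_of_nonneg_right h₂)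
    · exact (le_mbPrice hj hT hS).trans (le_add_of_nonneg_left h₁)
  · exact (mbPrice_le_iff _ _ _).2 ⟨mbPrice_nonneg _ _, fun j hj T hT hS =>
      le_mbPrice (Multiset.mem_cons_of_mem hj) hT hS⟩
end

section
/- If the type space Θ satisfies the submodularity condition, then the VCG mechanism is false-name-proof with withdrawal (FNPW): for any agent with true valuation θ_i ∈ Θ and any multiset θ_{-i} of others' valuations from Θ, submitting any finite collection of false-name reports from Θ and withdrawing any subset of them after the VCG allocation and payments are decided never yields higher utility than truthfully reporting with a single identity. -/
attribute [local instance] Classical.propDecidable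

variable {G : Type*} [Fintype G] [DecidableEq G]

/-- `U S L` is the maximal total value obtainable by allocating pairwise
disjoint sub-bundles of `S` to the agents in the list `L`. -/
noncomputable def U : Finset G → List (Valn G) → ℝ
  | _, [] => 0
  | S, w :: L => S.powerset.sup' (Finset.powerset_nonempty S) fun B => w.v B + U (S \ B) L

/-- The type space `Θ` satisfies the submodularity condition. -/
def SubmodularDomain (Θ : Set (Valn G)) : Prop :=
  ∀ (L : List (Valn G)), (∀ w ∈ L, w ∈ Θ) →
    ∀ S₁ S₂ : Finset G, U (S₁ ∪ S₂) L + U (S₁ ∩ S₂) L ≤ U S₁ L + U S₂ L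

/-- The VCG mechanism on the type space `Θ` is false-name-proof with
withdrawal: for any true type `θi ∈ Θ`, any others `θmi`, any kept false-name
reports `K` and withdrawn false-name reports `W` (all from `Θ`), and any
efficient allocation `A` for the manipulated profile `K ++ W ++ θmi`, the
utility the agent derives from the bundles of her kept identities at their VCG
prices never exceeds her truthful VCG utility `U(G, θi::θmi) − U(G, θmi)`. -/
def VCGFNPW (Θ : Set (Valn G)) : Prop :=
  ∀ θi : Valn G, θi ∈ Θ →
    ∀ θmi K W : List (Valn G),
      (∀ w ∈ θmi, w ∈ Θ) → (∀ w ∈ K, w ∈ Θ) → (∀ w ∈ W, w ∈ Θ) →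
      ∀ A : Fin (K ++ W ++ θmi).length → Finset G,
        (∀ i j, i ≠ j → Disjoint (A i) (A j)) →
        (∑ j, ((K ++ W ++ θmi).get j).v (A j) = U (Finset.univ : Finset G) (K ++ W ++ θmi)) →
        θi.v (Finset.univ.sup fun j : Fin K.length =>
            A (Fin.castLE (by simp only [List.length_append]; omega) j))
          - ∑ j : Fin K.length,
              (U (Finset.univ : Finset G) ((K ++ W ++ θmi).eraseIdx (j : ℕ))
                - U ((Finset.univ : Finset G) \
                      A (Fin.castLE (by simp only [List.length_append]; omega) j))
                    ((K ++ W ++ θmi).eraseIdx (j : ℕ)))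
        ≤ U (Finset.univ : Finset G) (θi :: θmi) - U (Finset.univ : Finset G) θmi

set_option linter.unusedSectionVars false

lemma le_U_cons {S B : Finset G} (hB : B ⊆ S) (w : Valn G) (L : List (Valn G)) :
    w.v B + U (S \ B) L ≤ U S (w :: L) :=
  Finset.le_sup' (fun B => w.v B + U (S \ B) L) (Finset.mem_powerset.2 hB)

lemma exists_U_cons_eq (S : Finset G) (w : Valn G) (L : List (Valn G)) :
    ∃ B ⊆ S, U S (w :: L) = w.v B + U (S \ B) L := by
  obtain ⟨B, hB, h⟩ := Finset.exists_mem_eq_sup' (Finset.powerset_nonempty S)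
    (fun B => w.v B + U (S \ B) L)
  exact ⟨B, Finset.mem_powerset.1 hB, h⟩

lemma sum_get_cons (w : Valn G) (L : List (Valn G)) (A : ℕ → Finset G) :
    ∑ j : Fin (w :: L).length, ((w :: L).get j).v (A j) =
      w.v (A 0) + ∑ j : Fin L.length, (L.get j).v (A (j + 1)) :=
  Fin.sum_univ_succ _

/-- Any feasible allocation has total value at most `U`. -/
lemma sum_le_U (L : List (Valn G)) (S : Finset G) (A : ℕ → Finset G)
    (hd : Pairwise fun i j => Disjoint (A i) (A j)) (hS : ∀ n, A n ⊆ S) :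
    ∑ j : Fin L.length, (L.get j).v (A j) ≤ U S L := by
  induction L generalizing S A with
  | nil => simp [U]
  | cons w L ih =>
    have h := ih (S \ A 0) (fun n => A (n + 1)) (fun i j hij => hd (by simpa using hij))
      (fun n => Finset.subset_sdiff.2 ⟨hS _, hd (by simp)⟩)
    have h' := le_U_cons (hS 0) w L
    rw [sum_get_cons]
    linarith

/-- Giving `B` to agent `j` and allocating the rest optimally to the others is feasible. -/
lemma add_U_eraseIdx_le (L : List (Valn G)) {S B : Finset G} (hB : B ⊆ S) (j : ℕ)
    (hj : j < L.length) : L[j].v B + U (S \ B) (L.eraseIdx j) ≤ U S L := by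
  induction L generalizing S j with
  | nil => simp at hj
  | cons w L ih =>
    cases j with
    | zero => simpa using le_U_cons hB w L
    | succ j =>
      simp only [List.getElem_cons_succ, List.eraseIdx_cons_succ]
      obtain ⟨C, hC, h⟩ := exists_U_cons_eq (S \ B) w (L.eraseIdx j)
      obtain ⟨hCS, hCB⟩ := Finset.subset_sdiff.1 hC
      have h₁ := ih (S := S \ C) (Finset.subset_sdiff.2 ⟨hB, hCB.symm⟩) j (by simpa using hj)
      have h₂ := le_U_cons hCS w L
      rw [sdiff_right_comm] at h₁
      linarith

/-- A feasible allocation is dominated by reoptimizing among all agents but `j`. -/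
lemma sum_le_add_U_eraseIdx (L : List (Valn G)) (S : Finset G) (A : ℕ → Finset G)
    (hd : Pairwise fun i j => Disjoint (A i) (A j)) (hS : ∀ n, A n ⊆ S) (j : ℕ)
    (hj : j < L.length) :
    ∑ l : Fin L.length, (L.get l).v (A l) ≤ L[j].v (A j) + U (S \ A j) (L.eraseIdx j) := by
  induction L generalizing S A j with
  | nil => simp at hj
  | cons w L ih =>
    have hd' : Pairwise fun i j => Disjoint (A (i + 1)) (A (j + 1)) :=
      fun i j hij => hd (by simpa using hij)
    have hS' : ∀ n, A (n + 1) ⊆ S \ A 0 := fun n => Finset.subset_sdiff.2 ⟨hS _, hd (by simp)⟩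
    rw [sum_get_cons]
    cases j with
    | zero => simpa using sum_le_U L (S \ A 0) _ hd' hS'
    | succ j =>
      simp only [List.getElem_cons_succ, List.eraseIdx_cons_succ]
      have h₁ := ih (S \ A 0) _ hd' hS' j (by simpa using hj)
      have h₂ := le_U_cons (S := S \ A (j + 1)) (B := A 0)
        (Finset.subset_sdiff.2 ⟨hS _, hd (by simp)⟩) w (L.eraseIdx j)
      rw [sdiff_right_comm] at h₁
      linarith

/-- The marginal value of a bundle does not decrease when agents join. -/
lemma SubmodularDomain.U_sub_le_U_append_sub {Θ : Set (Valn G)} (hsub : SubmodularDomain Θ)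
    (K M : List (Valn G)) (hK : ∀ w ∈ K, w ∈ Θ) (hM : ∀ w ∈ M, w ∈ Θ) (S B : Finset G) :
    U S M - U (S \ B) M ≤ U S (K ++ M) - U (S \ B) (K ++ M) := by
  induction K with
  | nil => simp
  | cons w K ih =>
    simp only [List.mem_cons, forall_eq_or_imp] at hK
    refine (ih hK.2).trans ?_
    rw [List.cons_append]
    obtain ⟨C, hC, h⟩ := exists_U_cons_eq (S \ B) w (K ++ M)
    obtain ⟨hCS, hCB⟩ := Finset.subset_sdiff.1 hC
    have h₁ := le_U_cons hCS w (K ++ M)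
    have h₂ := hsub (K ++ M) (by simpa [or_imp, forall_and] using ⟨hK.2, hM⟩) (S \ B) (S \ C)
    rw [← Finset.sup_eq_union, ← Finset.inf_eq_inter, ← sdiff_inf, hCB.symm.eq_bot, sdiff_bot,
      ← sdiff_sup, ← sdiff_sdiff_left] at h₂
    linarith

/-- In an efficient allocation to `K ++ M`, the total VCG price of the bundles of `K` is at least
the loss of the agents in `M` from removing all these bundles. -/
lemma SubmodularDomain.U_sub_le_sum_prices {Θ : Set (Valn G)} (hsub : SubmodularDomain Θ)
    (K M : List (Valn G)) (hK : ∀ w ∈ K, w ∈ Θ) (hM : ∀ w ∈ M, w ∈ Θ) (S : Finset G)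
    (A : ℕ → Finset G) (hd : Pairwise fun i j => Disjoint (A i) (A j)) (hS : ∀ n, A n ⊆ S)
    (hA : U S (K ++ M) ≤ ∑ j : Fin (K ++ M).length, ((K ++ M).get j).v (A j)) :
    U S M - U (S \ Finset.univ.sup fun j : Fin K.length => A j) M ≤
      ∑ j : Fin K.length,
        (U S ((K ++ M).eraseIdx j) - U (S \ A j) ((K ++ M).eraseIdx j)) := by
  induction K generalizing S A with
  | nil => simp
  | cons w K ih =>
    simp only [List.mem_cons, forall_eq_or_imp] at hK
    have hd' : Pairwise fun i j => Disjoint (A (i + 1)) (A (j + 1)) :=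
      fun i j hij => hd (by simpa using hij)
    have hS' : ∀ n, A (n + 1) ⊆ S \ A 0 := fun n => Finset.subset_sdiff.2 ⟨hS _, hd (by simp)⟩
    simp only [List.cons_append] at hA ⊢
    rw [sum_get_cons] at hA
    have h₁ := le_U_cons (hS 0) w (K ++ M)
    have h₂ := ih hK.2 (S \ A 0) _ hd' hS' (by linarith)
    have h₃ := hsub.U_sub_le_U_append_sub K M hK.2 hM S (A 0)
    have hsup : (S \ Finset.univ.sup fun j : Fin (w :: K).length => A j) =
        (S \ A 0) \ Finset.univ.sup fun j : Fin K.length => A (j + 1) := by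
      rw [sdiff_sdiff_left]
      congr 1
      simp only [List.length_cons, Fin.univ_succ, Finset.sup_cons, Finset.sup_map]
      rfl
    have h₄ : ∀ j : Fin K.length,
        U (S \ A 0) ((K ++ M).eraseIdx j) - U ((S \ A 0) \ A (j + 1)) ((K ++ M).eraseIdx j) ≤
          U S (w :: (K ++ M).eraseIdx j) - U (S \ A (j + 1)) (w :: (K ++ M).eraseIdx j) := by
      intro j
      have hj : (j : ℕ) < (K ++ M).length := by simp; omega
      have e₁ := le_U_cons (hS 0) w ((K ++ M).eraseIdx j)
      have e₂ := add_U_eraseIdx_le (w :: (K ++ M)) (hS (j + 1)) (j + 1) (by simpa using hj)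
      have e₃ := sum_le_add_U_eraseIdx (K ++ M) (S \ A 0) _ hd' hS' j hj
      simp only [List.getElem_cons_succ, List.eraseIdx_cons_succ] at e₂
      linarith
    have h₅ := Finset.sum_le_sum fun j (_ : j ∈ Finset.univ) => h₄ j
    rw [hsup]
    simp only [List.length_cons, Fin.sum_univ_succ, Fin.val_zero, Fin.val_succ,
      List.eraseIdx_cons_zero, List.eraseIdx_cons_succ]
    linarith

/-- If the type space satisfies the submodularity condition, then the VCG
mechanism is false-name-proof with withdrawal. -/
theorem submodular_implies_vcg_fnpw (Θ : Set (Valn G))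
    (hsub : SubmodularDomain Θ) : VCGFNPW Θ := by
  intro θi _ θmi K W hmi hK hW A hd hA
  obtain ⟨A', hA'⟩ : ∃ A' : ℕ → Finset G,
      A' = fun n => if h : n < (K ++ W ++ θmi).length then A ⟨n, h⟩ else ∅ := ⟨_, rfl⟩
  have hAA : ∀ j : Fin (K ++ W ++ θmi).length, A j = A' j := fun j => by simp only [hA', j.isLt, dite_true, Fin.eta]
  have hd' : Pairwise fun i j => Disjoint (A' i) (A' j) := by
    intro i j hij
    simp only [hA']
    split_ifs
    · exact hd _ _ (by simpa using hij)
    all_goals simp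
  have hWM : ∀ w ∈ W ++ θmi, w ∈ Θ := by simpa [or_imp, forall_and] using ⟨hW, hmi⟩
  simp only [hAA, Fin.val_castLE] at hA ⊢
  rw [List.append_assoc] at hA ⊢
  have h₁ := hsub.U_sub_le_sum_prices K (W ++ θmi) hK hWM Finset.univ A' hd'
    (fun _ => Finset.subset_univ _) hA.ge
  have h₂ := hsub.U_sub_le_U_append_sub W θmi hW hmi Finset.univ
    (Finset.univ.sup fun j : Fin K.length => A' j)
  have h₃ := le_U_cons (Finset.subset_univ (Finset.univ.sup fun j : Fin K.length => A' j)) θi θmi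
  linarith
end

section
/- The worst-case efficiency ratio of the Set mechanism is at least 1/m: for every finite multiset O of valuations, max_{j∈O} v_j(G) ≥ (1/m) · U(G, O), where U(G, O) is the maximum of Σ_{j∈O} v_j(B_j) over all families of pairwise disjoint bundles B_j ⊆ G assigned to the agents j ∈ O. -/
attribute [local instance] Classical.propDecidable

variable {G : Type*} [Fintype G] [DecidableEq G]

theorem U_le_card_mul (L : List (Valn G)) {M : ℝ} (hM : 0 ≤ M)
    (hL : ∀ w ∈ L, ∀ S, w.v S ≤ M) (S : Finset G) : U S L ≤ (S.card : ℝ) * M := by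
  induction L generalizing S with
  | nil => simpa [U] using mul_nonneg (Nat.cast_nonneg S.card) hM
  | cons w L ih =>
    rw [U]
    refine Finset.sup'_le _ _ fun B hB => ?_
    have hrest := ih (fun w' hw' => hL w' (List.mem_cons_of_mem _ hw')) (S \ B)
    have hcard : ((S \ B).card : ℝ) + B.card = S.card := by
      exact_mod_cast Finset.card_sdiff_add_card_eq_card (Finset.mem_powerset.mp hB)
    have hw : w.v B ≤ (B.card : ℝ) * M := by
      rcases B.eq_empty_or_nonempty with rfl | hne
      · simp [w.v_empty]
      · have h1 : (1 : ℝ) ≤ B.card := by exact_mod_cast hne.card_pos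
        exact (hL w List.mem_cons_self B).trans (le_mul_of_one_le_left hM h1)
    rw [← hcard, add_mul]
    linarith

theorem List.foldr_max_zero_nonneg (l : List ℝ) : 0 ≤ l.foldr max 0 := by
  induction l with
  | nil => simp
  | cons a l ih => exact le_max_of_le_right ih

theorem List.le_foldr_max_of_mem {l : List ℝ} {a : ℝ} (b : ℝ) (h : a ∈ l) :
    a ≤ l.foldr max b := by
  induction l with
  | nil => simp at h
  | cons c l ih =>
    rcases List.mem_cons.mp h with rfl | h
    · exact le_max_left _ _
    · exact le_max_of_le_right (ih h)

/-- **Worst-case efficiency ratio of the Set mechanism.** On every profile `O`,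
the allocative efficiency of the Set mechanism — the winner's value
`max_{j ∈ O} v_j(G)` for the grand bundle — is at least `1/m` times the
optimal allocative efficiency `U(G, O)`, where `m` is the number of items. -/
theorem set_mechanism_efficiency_ratio (O : List (Valn G)) :
    (1 / (Fintype.card G : ℝ)) * U (Finset.univ : Finset G) O
      ≤ (O.map fun j => j.v Finset.univ).foldr max 0 := by
  have hM := List.foldr_max_zero_nonneg (O.map fun j => j.v Finset.univ)
  have hU := U_le_card_mul O hM (fun w hw S => (w.v_mono (Finset.subset_univ S)).trans
    (List.le_foldr_max_of_mem 0 (List.mem_map_of_mem hw))) Finset.univ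
  rw [Finset.card_univ] at hU
  rcases Nat.eq_zero_or_pos (Fintype.card G) with h0 | hpos
  · simpa [h0] using hM
  · rw [one_div, inv_mul_le_iff₀ (by exact_mod_cast hpos)]
    exact hU
end

section
/- The price function of the MMVIP mechanism satisfies S-NSAW, i.e., it satisfies both DLB (for every multiset O of valuations and all disjoint S₁, S₂ ⊆ G, χ(S₁,O) + χ(S₂,O) ≥ χ(S₁ ∪ S₂,O); indeed with equality) and PIA (for every multiset O, every valuation a ∉ O, and every S ⊆ G, χ(S, O ∪ {a}) ≥ χ(S,O)); consequently MMVIP is FNPW. -/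
attribute [local instance] Classical.propDecidable

variable {G : Type*} [Fintype G] [DecidableEq G]

/-- The maximum marginal value of item `s` over the agents in `O`:
`max_{j ∈ O} max_{S ⊆ G∖{s}} (v_j(S∪{s}) − v_j(S))` (`0` if `O` is empty). -/
noncomputable def itemPrice (s : G) (O : Multiset (Valn G)) : ℝ :=
  (O.map fun j =>
    ((Finset.univ.erase s).powerset.sup' (Finset.powerset_nonempty _)
      fun S => j.v (insert s S) - j.v S)).fold max 0

/-- The price function of the maximum marginal value item pricing (MMVIP)
mechanism: item pricing with `χ(S,O) = Σ_{s∈S} χ({s},O)`. -/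
noncomputable def mmvipPrice (S : Finset G) (O : Multiset (Valn G)) : ℝ :=
  ∑ s ∈ S, itemPrice s O

theorem itemPrice_le_cons (s : G) (a : Valn G) (O : Multiset (Valn G)) :
    itemPrice s O ≤ itemPrice s (a ::ₘ O) := by
  simp only [itemPrice, Multiset.map_cons, Multiset.fold_cons_left]
  exact le_max_right _ _

theorem itemPrice_mono (s : G) {O O' : Multiset (Valn G)} (h : O ≤ O') :
    itemPrice s O ≤ itemPrice s O' := by
  obtain ⟨W, rfl⟩ := Multiset.le_iff_exists_add.1 h
  clear h
  induction W using Multiset.induction with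
  | empty => simp
  | cons a W ih =>
    rw [Multiset.add_cons]
    exact ih.trans (itemPrice_le_cons s a _)

theorem itemPrice_nonneg (s : G) (O : Multiset (Valn G)) : 0 ≤ itemPrice s O :=
  calc (0 : ℝ) = itemPrice s 0 := by simp [itemPrice]
    _ ≤ itemPrice s O := itemPrice_mono s (Multiset.zero_le O)

theorem mmvipPrice_mono_right (S : Finset G) {O O' : Multiset (Valn G)} (h : O ≤ O') :
    mmvipPrice S O ≤ mmvipPrice S O' :=
  Finset.sum_le_sum fun s _ => itemPrice_mono s h

theorem mmvipPrice_union_le (S T : Finset G) (O : Multiset (Valn G)) :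
    mmvipPrice (S ∪ T) O ≤ mmvipPrice S O + mmvipPrice T O := by
  have h : mmvipPrice (S ∪ T) O + mmvipPrice (S ∩ T) O = mmvipPrice S O + mmvipPrice T O :=
    Finset.sum_union_inter
  have h_inter : 0 ≤ mmvipPrice (S ∩ T) O :=
    Finset.sum_nonneg fun s _ => itemPrice_nonneg s O
  linarith

theorem mmvipPrice_sup_le {ι : Type*} (T : Finset ι) (f : ι → Finset G)
    (O : Multiset (Valn G)) :
    mmvipPrice (T.sup f) O ≤ ∑ j ∈ T, mmvipPrice (f j) O := by
  induction T using Finset.cons_induction with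
  | empty => simp [mmvipPrice]
  | cons a T ha ih =>
    rw [Finset.sup_cons, Finset.sum_cons]
    exact (mmvipPrice_union_le _ _ O).trans (by gcongr)

/-- The MMVIP price function satisfies S-NSAW — DLB (with equality) and
PIA — and consequently the MMVIP mechanism is FNPW. -/
theorem mmvip_snsaw_fnpw :
    (∀ (O : Multiset (Valn G)) (S₁ S₂ : Finset G), Disjoint S₁ S₂ →
      mmvipPrice (S₁ ∪ S₂) O = mmvipPrice S₁ O + mmvipPrice S₂ O) ∧
    (∀ (O : Multiset (Valn G)) (a : Valn G), a ∉ O →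
      ∀ S : Finset G, mmvipPrice S O ≤ mmvipPrice S (a ::ₘ O)) ∧
    (∀ X : Valn G → Multiset (Valn G) → Finset G,
      IsPORF mmvipPrice X → FNPW mmvipPrice X) := by
  refine ⟨fun O S₁ S₂ h => Finset.sum_union h,
    fun O a _ S => mmvipPrice_mono_right S (Multiset.le_cons_self O a), ?_⟩
  intro X hX θi θmi k kept W
  refine le_trans ?_ (hX θi θmi (Finset.univ.sup fun j => X (kept j) (othersOf kept j θmi W)))
  refine sub_le_sub_left ((mmvipPrice_sup_le _ _ _).trans ?_) _
  refine Finset.sum_le_sum fun j _ => mmvipPrice_mono_right _ ?_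
  exact (Multiset.le_add_right _ _).trans (Multiset.le_add_right _ _)
end

section
/- Under the MMVIP mechanism, no two agents can both strictly prefer winning a common item: for any multiset of agents, any item s, and any two distinct agents i and j, if a bundle containing s maximizes v_i(·) − χ(·, O_{-i}) and a bundle containing s maximizes v_j(·) − χ(·, O_{-j}), then each of i and j is indifferent between her maximizing bundle and that bundle with s removed; hence, with appropriate tie-breaking, MMVIP never allocates the same item to two different agents (MMVIP is feasible). -/
attribute [local instance] Classical.propDecidable

variable {G : Type*} [Fintype G] [DecidableEq G]

/-- A bundle maximizing the quasi-linear utility of `θ` at the MMVIP prices set by `O`. -/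
def IsDemanded (θ : Valn G) (O : Multiset (Valn G)) (B : Finset G) : Prop :=
  ∀ S : Finset G, θ.v S - mmvipPrice S O ≤ θ.v B - mmvipPrice B O

lemma le_fold_max_of_mem {a : ℝ} {M : Multiset ℝ} (h : a ∈ M) (b : ℝ) : a ≤ M.fold max b := by
  induction M using Multiset.induction_on with
  | empty => simp at h
  | cons c M ih =>
    rw [Multiset.fold_cons_left]
    rcases Multiset.mem_cons.1 h with rfl | h
    · exact le_max_left _ _
    · exact (ih h).trans (le_max_right _ _)

lemma marginal_le_itemPrice {θ : Valn G} {O : Multiset (Valn G)} (hθ : θ ∈ O) {s : G}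
    {B : Finset G} (hs : s ∈ B) : θ.v B - θ.v (B.erase s) ≤ itemPrice s O := by
  refine le_trans ?_ (le_fold_max_of_mem (Multiset.mem_map_of_mem _ hθ) 0)
  have hB : B.erase s ∈ (Finset.univ.erase s).powerset :=
    Finset.mem_powerset.2 (Finset.erase_subset_erase s (Finset.subset_univ B))
  have := Finset.le_sup' (fun S => θ.v (insert s S) - θ.v S) hB
  simpa only [Finset.insert_erase hs] using this

lemma mmvipPrice_erase_add (O : Multiset (Valn G)) {s : G} {B : Finset G} (hs : s ∈ B) :
    mmvipPrice (B.erase s) O + itemPrice s O = mmvipPrice B O :=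
  Finset.sum_erase_add B (fun t => itemPrice t O) hs

lemma IsDemanded.itemPrice_le_marginal {θ : Valn G} {O : Multiset (Valn G)} {B : Finset G}
    (h : IsDemanded θ O B) {s : G} (hs : s ∈ B) :
    itemPrice s O ≤ θ.v B - θ.v (B.erase s) := by
  have := h (B.erase s)
  have := mmvipPrice_erase_add O hs
  linarith

/-- An agent demanding `s` is indifferent to dropping it when another agent, whose prices
include the first agent's marginal values, also demands `s`. -/
lemma IsDemanded.utility_erase_eq {θ θ' : Valn G} {O O' : Multiset (Valn G)} {B B' : Finset G}
    (h : IsDemanded θ O B) (h' : IsDemanded θ' O' B') (hθ : θ ∈ O') (hθ' : θ' ∈ O) {s : G}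
    (hs : s ∈ B) (hs' : s ∈ B') :
    θ.v B - mmvipPrice B O = θ.v (B.erase s) - mmvipPrice (B.erase s) O := by
  have := h.itemPrice_le_marginal hs
  have := h'.itemPrice_le_marginal hs'
  have := marginal_le_itemPrice hθ hs
  have := marginal_le_itemPrice hθ' hs'
  have := mmvipPrice_erase_add O hs
  linarith

lemma exists_isDemanded_card_le (θ : Valn G) (O : Multiset (Valn G)) :
    ∃ B, IsDemanded θ O B ∧ ∀ S, IsDemanded θ O S → B.card ≤ S.card := by
  obtain ⟨B₀, hB₀⟩ := Finite.exists_max fun S : Finset G => θ.v S - mmvipPrice S O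
  obtain ⟨B, hB, hmin⟩ := Set.exists_min_image {B | IsDemanded θ O B} Finset.card
    (Set.toFinite _) ⟨B₀, hB₀⟩
  exact ⟨B, hB, hmin⟩

/-- **Feasibility of MMVIP.** Under MMVIP, no two agents can both strictly
prefer winning a common item: if, in a profile `ag` of `k` agents, the bundles
`Bi` and `Bj` both contain the item `s` and maximize the respective utilities
of the distinct agents `i ≠ j`, then each of the two agents is indifferent
between her maximizing bundle and that bundle with `s` removed.  Hence, with
appropriate tie-breaking, MMVIP never allocates an item to two agents: there is
a feasible utility-maximizing allocation rule for MMVIP. -/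
theorem mmvip_feasible :
    (∀ (k : ℕ) (ag : Fin k → Valn G) (i j : Fin k), i ≠ j →
      ∀ (s : G) (Bi Bj : Finset G), s ∈ Bi → s ∈ Bj →
      (∀ S : Finset G, (ag i).v S - mmvipPrice S ((Finset.univ.erase i).val.map ag)
          ≤ (ag i).v Bi - mmvipPrice Bi ((Finset.univ.erase i).val.map ag)) →
      (∀ S : Finset G, (ag j).v S - mmvipPrice S ((Finset.univ.erase j).val.map ag)
          ≤ (ag j).v Bj - mmvipPrice Bj ((Finset.univ.erase j).val.map ag)) →
      ((ag i).v Bi - mmvipPrice Bi ((Finset.univ.erase i).val.map ag)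
          = (ag i).v (Bi.erase s) - mmvipPrice (Bi.erase s) ((Finset.univ.erase i).val.map ag)) ∧
      ((ag j).v Bj - mmvipPrice Bj ((Finset.univ.erase j).val.map ag)
          = (ag j).v (Bj.erase s) - mmvipPrice (Bj.erase s) ((Finset.univ.erase j).val.map ag))) ∧
    (∃ X : Valn G → Multiset (Valn G) → Finset G,
      (∀ (θ : Valn G) (O : Multiset (Valn G)) (S : Finset G),
        θ.v S - mmvipPrice S O ≤ θ.v (X θ O) - mmvipPrice (X θ O) O) ∧
      (∀ (k : ℕ) (ag : Fin k → Valn G) (i j : Fin k), i ≠ j →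
        Disjoint (X (ag i) ((Finset.univ.erase i).val.map ag))
                 (X (ag j) ((Finset.univ.erase j).val.map ag)))) := by
  have hmem : ∀ (k : ℕ) (ag : Fin k → Valn G) (i j : Fin k), i ≠ j →
      ag i ∈ (Finset.univ.erase j).val.map ag := fun k ag i j hij =>
    Multiset.mem_map_of_mem ag (Finset.mem_erase.2 ⟨hij, Finset.mem_univ i⟩)
  refine ⟨fun k ag i j hij s Bi Bj hsi hsj hi hj => ?_, ?_⟩
  · have hmi := hmem k ag i j hij
    have hmj := hmem k ag j i hij.symm
    exact ⟨IsDemanded.utility_erase_eq hi hj hmi hmj hsi hsj,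
      IsDemanded.utility_erase_eq hj hi hmj hmi hsj hsi⟩
  · choose X hX hmin using exists_isDemanded_card_le (G := G)
    refine ⟨X, hX, fun k ag i j hij => Finset.disjoint_left.2 fun s hsi hsj => ?_⟩
    have heq := (hX _ _).utility_erase_eq (hX _ _) (hmem k ag i j hij)
      (hmem k ag j i hij.symm) hsi hsj
    exact (Finset.card_erase_lt_of_mem hsi).not_ge
      (hmin _ _ _ fun S => (hX _ _ S).trans_eq heq)
end

section
/- Among all feasible FNPW PORF mechanisms that use item pricing, MMVIP has minimal payments: let χ be the MMVIP price function and let χ' be the price function of a feasible FNPW PORF mechanism that also uses item pricing and satisfies consumer sovereignty; if χ' ≠ χ, then there exist a bundle S ⊆ G and a finite multiset O of valuations with χ'(S, O) > χ(S, O). -/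
attribute [local instance] Classical.propDecidable

variable {G : Type*} [Fintype G] [DecidableEq G]

/-- Feasibility: running the mechanism on any finite family of agents, no item
is ever allocated to two different agents. -/
def Feasible (X : Valn G → Multiset (Valn G) → Finset G) : Prop :=
  ∀ (k : ℕ) (ag : Fin k → Valn G) (i j : Fin k), i ≠ j →
    Disjoint (X (ag i) ((Finset.univ.erase i).val.map ag))
             (X (ag j) ((Finset.univ.erase j).val.map ag))

/-- The additive valuation with nonnegative item weights `w`. -/
def Valn.additive {G : Type*} (w : G → ℝ) (hw : ∀ t, 0 ≤ w t) : Valn G where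
  v S := ∑ t ∈ S, w t
  v_empty := Finset.sum_empty
  v_nonneg _ := Finset.sum_nonneg fun t _ => hw t
  v_mono _ _ h := Finset.sum_le_sum_of_subset_of_nonneg h fun t _ _ => hw t

theorem Multiset.fold_max_le_of_forall {s : Multiset ℝ} {a b : ℝ} (ha : a ≤ b)
    (h : ∀ x ∈ s, x ≤ b) : s.fold max a ≤ b := by
  induction s using Multiset.induction_on with
  | empty => simpa using ha
  | cons x s ih =>
    rw [Multiset.fold_cons_left]
    exact max_le (h x (Multiset.mem_cons_self x s))
      (ih fun y hy => h y (Multiset.mem_cons_of_mem hy))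

/-- The item price is below any nonnegative bound on the marginal values of the agents. -/
theorem itemPrice_le {s : G} {O : Multiset (Valn G)} {b : ℝ} (hb : 0 ≤ b)
    (h : ∀ j ∈ O, ∀ S : Finset G, s ∉ S → j.v (insert s S) - j.v S ≤ b) :
    itemPrice s O ≤ b := by
  refine Multiset.fold_max_le_of_forall hb fun x hx => ?_
  obtain ⟨j, hj, rfl⟩ := Multiset.mem_map.1 hx
  refine Finset.sup'_le _ _ fun S hS => ?_
  exact h j hj S fun hs => Finset.notMem_erase s _ (Finset.mem_powerset.1 hS hs)

theorem itemPrice_additive_le (w : G → ℝ) (hw : ∀ t, 0 ≤ w t) (s : G) :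
    itemPrice s {Valn.additive w hw} ≤ w s := by
  refine itemPrice_le (hw s) fun j hj S hs => ?_
  rw [Multiset.mem_singleton.1 hj]
  simp [Valn.additive, Finset.sum_insert hs]

/-- Under item pricing, an additive agent buys every item that she values above its price. -/
theorem IsPORF.mem_of_price_lt {G : Type*} [DecidableEq G]
    {χ : Finset G → Multiset (Valn G) → ℝ}
    {p : G → Multiset (Valn G) → ℝ} (hitem : ∀ S O, χ S O = ∑ s ∈ S, p s O)
    {X : Valn G → Multiset (Valn G) → Finset G} (hX : IsPORF χ X)
    {w : G → ℝ} (hw : ∀ t, 0 ≤ w t) {s : G} {O : Multiset (Valn G)} (h : p s O < w s) :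
    s ∈ X (Valn.additive w hw) O := by
  by_contra hs
  have := hX (Valn.additive w hw) O (insert s (X (Valn.additive w hw) O))
  rw [hitem, hitem] at this
  simp only [Valn.additive] at this hs
  rw [Finset.sum_insert hs, Finset.sum_insert hs] at this
  linarith

/-- In an FNPW mechanism with item pricing, item prices do not decrease when further agents
are added. -/
theorem FNPW.price_le_price_add {G : Type*} [DecidableEq G]
    {χ : Finset G → Multiset (Valn G) → ℝ}
    {p : G → Multiset (Valn G) → ℝ} (hitem : ∀ S O, χ S O = ∑ s ∈ S, p s O)
    (hp : ∀ s O, 0 ≤ p s O)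
    {X : Valn G → Multiset (Valn G) → Finset G} (hX : IsPORF χ X) (hF : FNPW χ X)
    (s : G) (O W : Multiset (Valn G)) : p s O ≤ p s (O + W) := by
  by_contra! hlt
  have hw : ∀ t, 0 ≤ (fun t => if t = s then p s O else 0) t := fun t => by
    dsimp only
    split_ifs
    exacts [hp s O, le_rfl]
  set θ : Valn G := Valn.additive _ hw with hθ
  have hF' := hF θ O 1 (fun _ => θ) W
  have ho : othersOf (fun _ : Fin 1 => θ) 0 O W = O + W := by simp [othersOf]
  simp only [Finset.univ_unique, Fin.default_eq_zero, Fin.isValue, Finset.sup_singleton,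
    Finset.sum_singleton, ho] at hF'
  have hbuy := hX θ (O + W) {s}
  have hval : ∀ S : Finset G, θ.v S = if s ∈ S then p s O else 0 := fun S => by
    simp [hθ, Valn.additive]
  have hcost : θ.v (X θ O) ≤ χ (X θ O) O := by
    rw [hval, hitem]
    split_ifs with hs
    · exact Finset.single_le_sum (f := fun t => p t O) (fun t _ => hp t O) hs
    · exact Finset.sum_nonneg fun t _ => hp t O
  rw [hval {s}, hitem {s}] at hbuy
  simp only [Finset.mem_singleton, if_true, Finset.sum_singleton] at hbuy
  linarith

theorem Feasible.disjoint_pair {G : Type*}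
    {X : Valn G → Multiset (Valn G) → Finset G} (hX : Feasible X)
    (i j : Valn G) : Disjoint (X i {j}) (X j {i}) := by
  have h := hX 2 ![i, j] 0 1 (by decide)
  have h0 : (Finset.univ.erase (0 : Fin 2)).val = {1} := by decide
  have h1 : (Finset.univ.erase (1 : Fin 2)).val = {0} := by decide
  rw [h0, h1] at h
  simpa using h

/-- If item prices of a feasible mechanism never exceed those of MMVIP, then an agent facing
a single agent `j` pays for an item at least each marginal value of `j` for it. -/
theorem marginal_le_price_singleton {χ : Finset G → Multiset (Valn G) → ℝ}
    {p : G → Multiset (Valn G) → ℝ} (hitem : ∀ S O, χ S O = ∑ s ∈ S, p s O)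
    (hp : ∀ s O, 0 ≤ p s O) (hle : ∀ s O, p s O ≤ itemPrice s O)
    {X : Valn G → Multiset (Valn G) → Finset G} (hX : IsPORF χ X) (hfeas : Feasible X)
    (j : Valn G) (s : G) (S : Finset G) (hs : s ∉ S) :
    j.v (insert s S) - j.v S ≤ p s {j} := by
  by_contra! hlt
  obtain ⟨c, hpc, hc⟩ := exists_between hlt
  let w : G → ℝ := fun t => if t ∈ S then 0 else if t = s then c else p t {j} + 1
  have hw : ∀ t, 0 ≤ w t := fun t => by
    have := hp t {j}
    have := hp s {j}
    dsimp only [w]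
    split_ifs <;> linarith
  have hwin : ∀ t ∉ S, t ∈ X (Valn.additive w hw) {j} := fun t ht => by
    refine hX.mem_of_price_lt hitem hw ?_
    by_cases hts : t = s
    · subst hts
      simpa [w, ht] using hpc
    · simp [w, ht, hts]
  have hsub : X j {Valn.additive w hw} ⊆ S := fun t ht => by
    by_contra htS
    exact Finset.disjoint_left.1 (hfeas.disjoint_pair (Valn.additive w hw) j) (hwin t htS) ht
  have hcost : χ (insert s S) {Valn.additive w hw} ≤ c := by
    rw [hitem]
    calc ∑ t ∈ insert s S, p t {Valn.additive w hw} ≤ ∑ t ∈ insert s S, w t :=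
          Finset.sum_le_sum fun t _ => (hle t _).trans (itemPrice_additive_le w hw t)
      _ = c := by
          rw [Finset.sum_insert hs, Finset.sum_eq_zero fun t ht => by simp [w, ht]]
          simp [w, hs]
  have hopt := hX j {Valn.additive w hw} (insert s S)
  have hnonneg : 0 ≤ χ (X j {Valn.additive w hw}) {Valn.additive w hw} := by
    rw [hitem]
    exact Finset.sum_nonneg fun t _ => hp t _
  have := j.v_mono hsub
  linarith

/-- **MMVIP has minimal payments among item-pricing FNPW mechanisms.** If `χ'`
is the price function of a feasible FNPW PORF mechanism that uses item pricing
(prices being real numbers, every bundle can be won at some finite cost, i.e.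
consumer sovereignty holds) and `χ'` differs from the MMVIP price function,
then some bundle is strictly more expensive under `χ'` than under MMVIP for
some multiset of other agents. -/
theorem mmvip_minimal_payments
    (χ' : Finset G → Multiset (Valn G) → ℝ) (p : G → Multiset (Valn G) → ℝ)
    (hitem : ∀ S O, χ' S O = ∑ s ∈ S, p s O)
    (hχ' : IsPrice χ')
    (X' : Valn G → Multiset (Valn G) → Finset G)
    (hX' : IsPORF χ' X') (hfeas : Feasible X') (hFNPW : FNPW χ' X')
    (hne : χ' ≠ @mmvipPrice G _ _) :
    ∃ (S : Finset G) (O : Multiset (Valn G)), mmvipPrice S O < χ' S O := by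
  by_contra! hall
  have hp : ∀ s O, 0 ≤ p s O := fun s O => by simpa [hitem] using hχ'.1 {s} O
  have hle : ∀ s O, p s O ≤ itemPrice s O := fun s O => by
    simpa [hitem, mmvipPrice] using hall {s} O
  refine hne (funext₂ fun S O => ?_)
  rw [hitem, mmvipPrice]
  refine Finset.sum_congr rfl fun s _ => (hle s O).antisymm ?_
  refine itemPrice_le (hp s O) fun j hj T hs => ?_
  obtain ⟨W, rfl⟩ := Multiset.exists_cons_of_mem hj
  exact (marginal_le_price_singleton hitem hp hle hX' hfeas j s T hs).trans
    (hFNPW.price_le_price_add hitem hp hX' s {j} W)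
end

section
/- For every feasible price function χ and every function H assigning a nonnegative real H(O) to each finite multiset O of valuations, the modified price function χ^H — defined by χ^H(S, O) = χ(S, O) + H(O) for every nonempty S ⊆ G and χ^H(∅, O) = 0 — is feasible: the PORF mechanism with price function χ^H never allocates the same item to two different agents. -/
attribute [local instance] Classical.propDecidable

variable {G : Type*} [Fintype G] [DecidableEq G]

/-- The modified price function `χ^H`: the price of every nonempty bundle is
increased by `H(O)`, while the empty bundle stays free. -/
def modPrice (χ : Finset G → Multiset (Valn G) → ℝ)
    (H : Multiset (Valn G) → ℝ) : Finset G → Multiset (Valn G) → ℝ :=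
  fun S O => if S = ∅ then 0 else χ S O + H O

/-- The allocation rule that withholds the bundle of `X` from every agent whose utility
under `χ` does not exceed the additional fee `H`. -/
noncomputable def feeAlloc (χ : Finset G → Multiset (Valn G) → ℝ)
    (X : Valn G → Multiset (Valn G) → Finset G) (H : Multiset (Valn G) → ℝ) :
    Valn G → Multiset (Valn G) → Finset G :=
  fun θ O => if H O < θ.v (X θ O) - χ (X θ O) O then X θ O else ∅

theorem feeAlloc_subset {G : Type*} (χ : Finset G → Multiset (Valn G) → ℝ)
    (X : Valn G → Multiset (Valn G) → Finset G) (H : Multiset (Valn G) → ℝ)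
    (θ : Valn G) (O : Multiset (Valn G)) : feeAlloc χ X H θ O ⊆ X θ O := by
  unfold feeAlloc
  split_ifs <;> simp

theorem isPORF_feeAlloc {G : Type*} [DecidableEq G]
    {χ : Finset G → Multiset (Valn G) → ℝ} (hχ : IsPrice χ)
    {X : Valn G → Multiset (Valn G) → Finset G} (hX : IsPORF χ X)
    {H : Multiset (Valn G) → ℝ} (hH : ∀ O, 0 ≤ H O) :
    IsPORF (modPrice χ H) (feeAlloc χ X H) := by
  intro θ O S
  have hS := hX θ O S
  have hO := hH O
  by_cases h : H O < θ.v (X θ O) - χ (X θ O) O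
  · have hne : X θ O ≠ ∅ := by
      intro he
      rw [he, θ.v_empty, hχ.2.1] at h
      linarith
    by_cases hE : S = ∅
    · simp only [feeAlloc, modPrice, if_pos h, if_neg hne, hE, θ.v_empty]
      simp only [if_true]
      linarith
    · simp only [feeAlloc, modPrice, if_pos h, if_neg hne, if_neg hE]
      linarith
  · by_cases hE : S = ∅
    · simp [feeAlloc, modPrice, h, hE]
    · simp only [feeAlloc, modPrice, if_neg h, if_neg hE, θ.v_empty, if_true]
      linarith

/-- **Lemma (Yokoo et al.).** For every feasible price function `χ` and every
nonnegative `H`, the modified price function `χ^H` is feasible: the PORF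
mechanism with price function `χ^H` (with suitable tie-breaking) never
allocates the same item to two different agents. -/
theorem modPrice_feasible (χ : Finset G → Multiset (Valn G) → ℝ)
    (hχ : IsPrice χ)
    (X : Valn G → Multiset (Valn G) → Finset G)
    (hX : IsPORF χ X) (hfeas : Feasible X)
    (H : Multiset (Valn G) → ℝ) (hH : ∀ O, 0 ≤ H O) :
    ∃ X' : Valn G → Multiset (Valn G) → Finset G,
      IsPORF (modPrice χ H) X' ∧ Feasible X' := by
  exact ⟨feeAlloc χ X H, isPORF_feeAlloc hχ hX hH, fun k ag i j hij =>
    (hfeas k ag i j hij).mono (feeAlloc_subset ..) (feeAlloc_subset ..)⟩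
end

section
/- Let χ be a feasible price function and define H by recursion on the multiset O of valuations: H(O) is the maximum of (i) max over disjoint S₁, S₂ ⊆ G of χ(S₁∪S₂, O) − χ(S₁, O) − χ(S₂, O), and (ii) max over nonempty S ⊆ G and j ∈ O of χ(S, O−{j}) + H(O−{j}) − χ(S, O) (the maximum over an empty index set being 0). Then H(O) ≥ 0 for all O, and the modified price function χ^H (with χ^H(S,O) = χ(S,O) + H(O) for nonempty S and χ^H(∅,O) = 0) satisfies S-NSAW — both DLB and PIA — and hence the PORF mechanism with price function χ^H is FNPW. -/
attribute [local instance] Classical.propDecidable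

variable {G : Type*} [Fintype G] [DecidableEq G]

/-- Maximum of `f` over a finset, `0` if the index set is empty. -/
noncomputable def fmax {α : Type*} (s : Finset α) (f : α → ℝ) : ℝ :=
  if h : s.Nonempty then s.sup' h f else 0

/-- The automated-mechanism-design function `H`, defined by recursion on the
multiset `O`: `H(O)` is the maximum of
(i) `max_{S₁ ∩ S₂ = ∅} (χ(S₁∪S₂,O) − χ(S₁,O) − χ(S₂,O))` and
(ii) `max_{∅ ⊊ S ⊆ G, j ∈ O} (χ(S,O−{j}) + H(O−{j}) − χ(S,O))`
(the maximum over an empty index set being `0`). -/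
noncomputable def Hfun (χ : Finset G → Multiset (Valn G) → ℝ) :
    Multiset (Valn G) → ℝ :=
  fun O =>
    max
      (((Finset.univ : Finset (Finset G × Finset G)).filter
          fun q => Disjoint q.1 q.2).sup' ⟨(∅, ∅), by simp⟩
        fun q => χ (q.1 ∪ q.2) O - χ q.1 O - χ q.2 O)
      (fmax (O.toFinset.attach ×ˢ ((Finset.univ : Finset (Finset G)).filter fun S => S ≠ ∅))
        fun q => χ q.2 (O.erase q.1.1) + Hfun χ (O.erase q.1.1) - χ q.2 O)
termination_by O => Multiset.card O
decreasing_by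
  exact Multiset.card_erase_lt_of_mem (Multiset.mem_toFinset.mp q.1.2)

theorem le_fmax {α : Type*} {s : Finset α} (f : α → ℝ) {a : α} (ha : a ∈ s) :
    f a ≤ fmax s f := by
  rw [fmax, dif_pos ⟨a, ha⟩]
  exact Finset.le_sup' f ha

theorem le_Hfun_of_disjoint (χ : Finset G → Multiset (Valn G) → ℝ)
    (O : Multiset (Valn G)) {S₁ S₂ : Finset G} (h : Disjoint S₁ S₂) :
    χ (S₁ ∪ S₂) O - χ S₁ O - χ S₂ O ≤ Hfun χ O := by
  rw [Hfun]
  refine le_trans ?_ (le_max_left _ _)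
  exact Finset.le_sup' (fun q : Finset G × Finset G => χ (q.1 ∪ q.2) O - χ q.1 O - χ q.2 O)
    (b := (S₁, S₂)) (by simpa using h)

theorem le_Hfun_cons (χ : Finset G → Multiset (Valn G) → ℝ)
    (O : Multiset (Valn G)) (a : Valn G) {S : Finset G} (hS : S ≠ ∅) :
    χ S O + Hfun χ O ≤ χ S (a ::ₘ O) + Hfun χ (a ::ₘ O) := by
  have ha : a ∈ (a ::ₘ O).toFinset := by simp
  have key : χ S ((a ::ₘ O).erase a) + Hfun χ ((a ::ₘ O).erase a) - χ S (a ::ₘ O)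
      ≤ Hfun χ (a ::ₘ O) := by
    conv_rhs => rw [Hfun]
    refine le_trans ?_ (le_max_right _ _)
    exact le_fmax (fun q : {x // x ∈ (a ::ₘ O).toFinset} × Finset G =>
      χ q.2 ((a ::ₘ O).erase q.1.1) + Hfun χ ((a ::ₘ O).erase q.1.1) - χ q.2 (a ::ₘ O))
      (a := (⟨a, ha⟩, S)) (by simp [hS])
  rw [Multiset.erase_cons_head] at key
  linarith

theorem Hfun_nonneg {χ : Finset G → Multiset (Valn G) → ℝ} (hχ : IsPrice χ)
    (O : Multiset (Valn G)) : 0 ≤ Hfun χ O := by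
  have h := le_Hfun_of_disjoint χ O (disjoint_bot_left (a := (∅ : Finset G)))
  simpa [hχ.2.1] using h

theorem modPrice_empty {M : Type*} [DecidableEq M]
    (χ : Finset M → Multiset (Valn M) → ℝ) (H : Multiset (Valn M) → ℝ)
    (O : Multiset (Valn M)) : modPrice χ H ∅ O = 0 := if_pos rfl

theorem modPrice_of_ne_empty {M : Type*} [DecidableEq M]
    (χ : Finset M → Multiset (Valn M) → ℝ)
    (H : Multiset (Valn M) → ℝ) (O : Multiset (Valn M)) {S : Finset M} (hS : S ≠ ∅) :
    modPrice χ H S O = χ S O + H O := if_neg hS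

theorem modPrice_mono {M : Type*} [DecidableEq M]
    {χ : Finset M → Multiset (Valn M) → ℝ} (hχ : IsPrice χ)
    {H : Multiset (Valn M) → ℝ} {O : Multiset (Valn M)} (hH : 0 ≤ H O)
    {S T : Finset M} (h : S ⊆ T) : modPrice χ H S O ≤ modPrice χ H T O := by
  by_cases hT : T = ∅
  · rw [hT, Finset.subset_empty] at h
    rw [h, hT]
  · rw [modPrice_of_ne_empty χ H O hT]
    by_cases hS : S = ∅
    · rw [hS, modPrice_empty]
      exact add_nonneg (hχ.1 T O) hH
    · rw [modPrice_of_ne_empty χ H O hS]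
      linarith [hχ.2.2 h O]

theorem modPrice_union_le {χ : Finset G → Multiset (Valn G) → ℝ}
    (O : Multiset (Valn G)) {S₁ S₂ : Finset G} (h : Disjoint S₁ S₂) :
    modPrice χ (Hfun χ) (S₁ ∪ S₂) O
      ≤ modPrice χ (Hfun χ) S₁ O + modPrice χ (Hfun χ) S₂ O := by
  by_cases h₁ : S₁ = ∅
  · simp [h₁, modPrice_empty]
  by_cases h₂ : S₂ = ∅
  · simp [h₂, modPrice_empty]
  have h₃ : S₁ ∪ S₂ ≠ ∅ := fun h₃ => h₁ (Finset.union_eq_empty.mp h₃).1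
  rw [modPrice_of_ne_empty _ _ _ h₁, modPrice_of_ne_empty _ _ _ h₂,
    modPrice_of_ne_empty _ _ _ h₃]
  linarith [le_Hfun_of_disjoint χ O h]

theorem modPrice_le_cons (χ : Finset G → Multiset (Valn G) → ℝ)
    (O : Multiset (Valn G)) (a : Valn G) (S : Finset G) :
    modPrice χ (Hfun χ) S O ≤ modPrice χ (Hfun χ) S (a ::ₘ O) := by
  by_cases hS : S = ∅
  · simp [hS, modPrice_empty]
  · rw [modPrice_of_ne_empty _ _ _ hS, modPrice_of_ne_empty _ _ _ hS]
    exact le_Hfun_cons χ O a hS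

/-- A price that is monotone in the bundle and subadditive on disjoint bundles is
subadditive over arbitrary, possibly overlapping, finite families. -/
theorem price_sup_le_sum {ι M : Type*} [DecidableEq M] {p : Finset M → ℝ} (h0 : p ∅ = 0)
    (hmono : ∀ ⦃S T : Finset M⦄, S ⊆ T → p S ≤ p T)
    (hdlb : ∀ S T : Finset M, Disjoint S T → p (S ∪ T) ≤ p S + p T)
    (s : Finset ι) (B : ι → Finset M) : p (s.sup B) ≤ ∑ j ∈ s, p (B j) := by
  classical
  induction s using Finset.induction_on with
  | empty => simp [h0]
  | insert j s hj ih =>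
    rw [Finset.sup_insert, Finset.sum_insert hj, Finset.sup_eq_union,
      ← Finset.union_sdiff_self_eq_union]
    have h := hdlb (B j) (s.sup B \ B j) Finset.disjoint_sdiff
    have h' : p (s.sup B \ B j) ≤ p (s.sup B) := hmono Finset.sdiff_subset
    linarith

theorem le_add_of_le_cons {α : Type*} {f : Multiset α → ℝ}
    (hf : ∀ O a, f O ≤ f (a ::ₘ O)) (O P : Multiset α) : f O ≤ f (O + P) := by
  induction P using Multiset.induction_on with
  | empty => simp
  | cons a P ih => exact ih.trans (by simpa using hf (O + P) a)

/-- The sufficient condition S-NSAW (DLB together with PIA) implies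
false-name-proofness with withdrawal. -/
theorem FNPW_of_DLB_of_PIA {M : Type*} [DecidableEq M]
    {χ : Finset M → Multiset (Valn M) → ℝ}
    (h0 : ∀ O, χ ∅ O = 0) (hmono : ∀ O ⦃S T : Finset M⦄, S ⊆ T → χ S O ≤ χ T O)
    (hdlb : ∀ O (S T : Finset M), Disjoint S T → χ (S ∪ T) O ≤ χ S O + χ T O)
    (hpia : ∀ O a S, χ S O ≤ χ S (a ::ₘ O))
    {X : Valn M → Multiset (Valn M) → Finset M} (hX : IsPORF χ X) : FNPW χ X := by
  intro θi θmi k kept W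
  set B : Fin k → Finset M := fun j => X (kept j) (othersOf kept j θmi W)
  have hsup : χ (Finset.univ.sup B) θmi ≤ ∑ j, χ (B j) θmi :=
    price_sup_le_sum (h0 θmi) (hmono θmi) (hdlb θmi) Finset.univ B
  have hsum : ∑ j, χ (B j) θmi ≤ ∑ j, χ (B j) (othersOf kept j θmi W) := by
    refine Finset.sum_le_sum fun j _ => ?_
    rw [othersOf, add_assoc]
    exact le_add_of_le_cons (fun O a => hpia O a (B j)) θmi _
  have hbest := hX θi θmi (Finset.univ.sup B)
  linarith

/-- **The AMD transformation produces FNPW mechanisms.** For a feasible price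
function `χ`, the recursively defined `H` is nonnegative, and the modified
price function `χ^H` satisfies S-NSAW — both DLB and PIA — so that the PORF
mechanism with price function `χ^H` is FNPW. -/
theorem amd_produces_fnpw (χ : Finset G → Multiset (Valn G) → ℝ)
    (hχ : IsPrice χ)
    (hfeas : ∃ X : Valn G → Multiset (Valn G) → Finset G, IsPORF χ X ∧ Feasible X) :
    (∀ O : Multiset (Valn G), 0 ≤ Hfun χ O) ∧
    (∀ (O : Multiset (Valn G)) (S₁ S₂ : Finset G), Disjoint S₁ S₂ →
      modPrice χ (Hfun χ) (S₁ ∪ S₂) O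
        ≤ modPrice χ (Hfun χ) S₁ O + modPrice χ (Hfun χ) S₂ O) ∧
    (∀ (O : Multiset (Valn G)) (a : Valn G) (S : Finset G),
      modPrice χ (Hfun χ) S O ≤ modPrice χ (Hfun χ) S (a ::ₘ O)) ∧
    (∀ X : Valn G → Multiset (Valn G) → Finset G,
      IsPORF (modPrice χ (Hfun χ)) X → FNPW (modPrice χ (Hfun χ)) X) := by
  refine ⟨Hfun_nonneg hχ, fun O _ _ h => modPrice_union_le O h, modPrice_le_cons χ,
    fun X hX => ?_⟩
  exact FNPW_of_DLB_of_PIA (modPrice_empty χ _)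
    (fun O _ _ h => modPrice_mono hχ (Hfun_nonneg hχ O) h)
    (fun O _ _ h => modPrice_union_le O h) (modPrice_le_cons χ) hX
end

section
/- Suppose that for every outcome o ∈ Ω there exists a type θ ∈ Θ for which o is the unique maximizer of v(θ, ·) over Ω. Then a strategy-proof social choice function f is false-name-proof (equivalently, false-name-proof with withdrawal, as there are no payments) if and only if for every multiset θ_{-i} of types and every type θ₀ ∈ Θ, the attainable set shrinks when an agent is added: { f(θ_i, θ_{-i} ∪ {θ₀}) : θ_i ∈ Θ } ⊆ { f(θ_i, θ_{-i}) : θ_i ∈ Θ }. -/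
/-- If adding an agent shrinks the attainable set, then every outcome reached by a nonempty
multiset of reports is already reached by a single report. -/
theorem mem_range_cons_of_attainable_shrinks {Θ Ω : Type*} {f : Multiset Θ → Ω}
    (h : ∀ (s : Multiset Θ) (a : Θ),
      (Set.range fun b : Θ => f (b ::ₘ a ::ₘ s)) ⊆ Set.range fun b : Θ => f (b ::ₘ s))
    (s R : Multiset Θ) (a : Θ) :
    f (a ::ₘ (R + s)) ∈ Set.range fun b : Θ => f (b ::ₘ s) := by
  induction R using Multiset.induction_on generalizing a with
  | empty => exact ⟨a, by simp⟩
  | cons c R ih =>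
    obtain ⟨b, hb⟩ := h (R + s) c ⟨a, rfl⟩
    rw [Multiset.cons_add]
    exact Set.mem_of_eq_of_mem hb.symm (ih b)

/-- **Characterization of FNP(W) social choice functions.**
`Θ` is the type space, `Ω` the outcome space, `v θ ω` the utility of an agent
of type `θ` for outcome `ω`, and `f` a social choice function mapping every
finite multiset of reported types to an outcome.  Suppose every outcome is the
unique most-preferred outcome of some type, and `f` is strategy-proof.  Then
`f` is false-name-proof — truthful reporting with a single identity is at
least as good as submitting any nonempty finite multiset `R` of false-name
reports (equivalently false-name-proof with withdrawal, as there are no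
payments) — if and only if adding another agent `θ₀` can only shrink the set
of outcomes an agent can attain. -/
theorem fnp_iff_attainable_shrinks {Θ Ω : Type*}
    (v : Θ → Ω → ℝ) (f : Multiset Θ → Ω)
    (huniq : ∀ o : Ω, ∃ θ : Θ, ∀ o' : Ω, o' ≠ o → v θ o' < v θ o)
    (hsp : ∀ (θi θi' : Θ) (θmi : Multiset Θ),
      v θi (f (θi' ::ₘ θmi)) ≤ v θi (f (θi ::ₘ θmi))) :
    (∀ (θi : Θ) (θmi R : Multiset Θ), R ≠ 0 →
        v θi (f (R + θmi)) ≤ v θi (f (θi ::ₘ θmi)))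
      ↔ (∀ (θmi : Multiset Θ) (θ0 : Θ),
        (Set.range fun θi : Θ => f (θi ::ₘ θ0 ::ₘ θmi))
          ⊆ Set.range fun θi : Θ => f (θi ::ₘ θmi)) := by
  constructor
  · rintro hfnp θmi θ0 _ ⟨θi, rfl⟩
    obtain ⟨θ, hθ⟩ := huniq (f (θi ::ₘ θ0 ::ₘ θmi))
    refine ⟨θ, ?_⟩
    by_contra hne
    have hle := hfnp θ θmi {θi, θ0} (Multiset.cons_ne_zero)
    rw [Multiset.insert_eq_cons, Multiset.cons_add, Multiset.singleton_add] at hle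
    exact (hθ _ hne).not_ge hle
  · intro h θi θmi R hR
    obtain ⟨a, ha⟩ := Multiset.exists_mem_of_ne_zero hR
    obtain ⟨S, rfl⟩ := Multiset.exists_cons_of_mem ha
    obtain ⟨b, hb⟩ := mem_range_cons_of_attainable_shrinks h θmi S a
    rw [Multiset.cons_add]
    exact hb ▸ hsp θi b θmi
end
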